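/- arXiv:1002.4713 — 3 statements merged into one kernel-verified Lean document; each statement's English description precedes it below -/
import Mathlib

section
/- Let (X, ρ) be a compact metric space, μ a Borel probability measure on X, N a positive integer, and ε > 0. Then μ^N(D_ε) > 0, where μ^N is the N-fold product measure on X^N. -/
open MeasureTheory

/-- For a compact metric space `X`, a Borel probability measure `μ`, `N ≥ 1` and `ε > 0`,
the `ε`-neighborhood of the diagonal in `X^N` has positive product measure. -/
theorem diag_neighborhood_pos_measure
    {X : Type*} [MetricSpace X] [CompactSpace X]
    [MeasurableSpace X] [BorelSpace X]
    (μ : Measure X) [IsProbabilityMeasure μ]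
    (N : ℕ) (hN : 0 < N) (ε : ℝ) (hε : 0 < ε) :
    0 < Measure.pi (fun _ : Fin N => μ)
        {x : Fin N → X | ∀ i j : Fin N, dist (x i) (x j) ≤ ε} := by
  obtain ⟨a, -, ha⟩ := exists_mem_forall_mem_nhdsWithin_pos_measure
    (μ := μ) (s := Set.univ) (by simp)
  have hball : 0 < μ (Metric.ball a (ε / 2)) :=
    ha _ (mem_nhdsWithin_of_mem_nhds (Metric.ball_mem_nhds a (half_pos hε)))
  have hpi : 0 < Measure.pi (fun _ : Fin N => μ)
      (Set.univ.pi fun _ => Metric.ball a (ε / 2)) := by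
    rw [Measure.pi_pi, Finset.prod_const]
    exact ENNReal.pow_pos hball _
  refine hpi.trans_le (measure_mono fun x hx i j => ?_)
  have hi := Metric.mem_ball.1 (hx i trivial)
  have hj := Metric.mem_ball.1 (hx j trivial)
  linarith [dist_triangle_right (x i) (x j) a]
end

section
/- Let X̄ = [0,1]^N be the N-dimensional unit cube and let τ̄(x̄) := G x̄ + H be an affine map from X̄ into itself (G an N×N real matrix, H ∈ ℝ^N) such that for some α > 0, for every norm ℓ on ℝ^N and every ξ ∈ ℝ^N one has ℓ(Gξ) ≥ α·ℓ(ξ). Then for every finite signed Borel measure μ̄ on X̄ one has V̄(τ̄*μ̄) ≤ (1/α)·V̄(μ̄). -/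
open MeasureTheory Set

/-- Integral of a function against a finite signed Borel measure on `ℝ^N`, via the Jordan
decomposition. -/
noncomputable def sIntN {N : ℕ} (μ : SignedMeasure (Fin N → ℝ)) (f : (Fin N → ℝ) → ℝ) : ℝ :=
  (∫ x, f x ∂μ.toJordanDecomposition.posPart) - ∫ x, f x ∂μ.toJordanDecomposition.negPart

/-- A signed measure on `ℝ^N` concentrated on the unit cube `[0,1]^N`. -/
def ConcOnCube {N : ℕ} (μ : SignedMeasure (Fin N → ℝ)) : Prop :=
  μ.toJordanDecomposition.posPart (univ.pi fun _ : Fin N => Icc (0:ℝ) 1)ᶜ = 0 ∧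
  μ.toJordanDecomposition.negPart (univ.pi fun _ : Fin N => Icc (0:ℝ) 1)ᶜ = 0

/-- The variation `V̄(μ̄) = max_i sup {∫ ∂_i φ dμ̄ : φ ∈ C¹([0,1]^N), |φ| ≤ 1}`. -/
noncomputable def VvarN {N : ℕ} (μ : SignedMeasure (Fin N → ℝ)) : ℝ :=
  sSup {y | ∃ i : Fin N, ∃ φ : (Fin N → ℝ) → ℝ, ContDiff ℝ 1 φ ∧
    (∀ x ∈ univ.pi fun _ : Fin N => Icc (0:ℝ) 1, |φ x| ≤ 1) ∧
    y = sIntN μ (fun x => fderiv ℝ φ x (Pi.single i 1))}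

namespace MeasureTheory.SignedMeasure

variable {α β : Type*} [MeasurableSpace α] [MeasurableSpace β]

theorem toJordanDecomposition_map_parts (s : SignedMeasure α) {f : α → β}
    (hf : MeasurableEmbedding f) :
    (toJordanDecomposition (s.map f)).posPart = s.toJordanDecomposition.posPart.map f ∧
    (toJordanDecomposition (s.map f)).negPart = s.toJordanDecomposition.negPart.map f := by
  let j : JordanDecomposition β :=
    { posPart := s.toJordanDecomposition.posPart.map f
      negPart := s.toJordanDecomposition.negPart.map f
      mutuallySingular := hf.mutuallySingular_map s.toJordanDecomposition.mutuallySingular }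
  have h : (toJordanDecomposition (s.map f)) = j := by
    refine toJordanDecomposition_eq ?_
    ext i hi
    rw [VectorMeasure.map_apply _ hf.measurable hi,
      s.apply_eq_posPart_real_sub_negPart_real (hf.measurable hi),
      JordanDecomposition.toSignedMeasure, Measure.toSignedMeasure_sub_apply hi,
      map_measureReal_apply hf.measurable hi, map_measureReal_apply hf.measurable hi]
  rw [h]
  exact ⟨rfl, rfl⟩

end MeasureTheory.SignedMeasure

section Cube

variable {N : ℕ}

theorem sIntN_map (μ : SignedMeasure (Fin N → ℝ)) {T : (Fin N → ℝ) → Fin N → ℝ}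
    (hT : MeasurableEmbedding T) (f : (Fin N → ℝ) → ℝ) :
    sIntN (μ.map T) f = sIntN μ (fun x => f (T x)) := by
  obtain ⟨hp, hn⟩ := μ.toJordanDecomposition_map_parts hT
  rw [sIntN, hp, hn, hT.integral_map, hT.integral_map, sIntN]

theorem sIntN_const_mul (μ : SignedMeasure (Fin N → ℝ)) (c : ℝ) (f : (Fin N → ℝ) → ℝ) :
    sIntN μ (fun x => c * f x) = c * sIntN μ f := by
  simp only [sIntN, integral_const_mul, mul_sub]

theorem ConcOnCube.sIntN_congr {μ : SignedMeasure (Fin N → ℝ)} (hμ : ConcOnCube μ)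
    {f g : (Fin N → ℝ) → ℝ} (h : ∀ x ∈ univ.pi fun _ : Fin N => Icc (0:ℝ) 1, f x = g x) :
    sIntN μ f = sIntN μ g := by
  have key : ∀ m : Measure (Fin N → ℝ), m (univ.pi fun _ : Fin N => Icc (0:ℝ) 1)ᶜ = 0 →
      ∫ x, f x ∂m = ∫ x, g x ∂m := fun m hm => by
    refine integral_congr_ae ?_
    filter_upwards [mem_ae_iff.2 hm] with x hx using h x hx
  rw [sIntN, sIntN, key _ hμ.1, key _ hμ.2]

theorem measurableEmbedding_smul_add {c : ℝ} (hc : c ≠ 0) (H : Fin N → ℝ) :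
    MeasurableEmbedding (fun x : Fin N → ℝ => c • x + H) :=
  ((Homeomorph.smulOfNeZero c hc).trans (Homeomorph.addRight H)).measurableEmbedding

theorem fderiv_comp_smul_add {φ : (Fin N → ℝ) → ℝ} (hφ : ContDiff ℝ 1 φ) (c : ℝ)
    (H x v : Fin N → ℝ) :
    fderiv ℝ (fun y => φ (c • y + H)) x v = c * fderiv ℝ φ (c • x + H) v := by
  have h1 : HasFDerivAt (fun y : Fin N → ℝ => c • y + H)
      (c • ContinuousLinearMap.id ℝ (Fin N → ℝ)) x :=
    ((hasFDerivAt_id x).const_smul c).add_const H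
  have h2 := ((hφ.differentiable one_ne_zero (c • x + H)).hasFDerivAt).comp x h1
  have h3 : fderiv ℝ (fun y => φ (c • y + H)) x = _ := h2.fderiv
  rw [h3]
  simp

theorem sIntN_map_smul_add (μ : SignedMeasure (Fin N → ℝ)) {c : ℝ} (hc : c ≠ 0)
    (H v : Fin N → ℝ) {φ : (Fin N → ℝ) → ℝ} (hφ : ContDiff ℝ 1 φ) :
    sIntN (μ.map fun x => c • x + H) (fun x => fderiv ℝ φ x v) =
      c⁻¹ * sIntN μ (fun x => fderiv ℝ (fun y => φ (c • y + H)) x v) := by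
  rw [sIntN_map μ (measurableEmbedding_smul_add hc H), ← sIntN_const_mul]
  simp only [fderiv_comp_smul_add hφ, inv_mul_cancel_left₀ hc]

/-- A `C¹` function bounded by `1` on a set agrees near that set with a globally bounded one. -/
theorem exists_contDiff_bounded_eventuallyEq {φ : (Fin N → ℝ) → ℝ} (hφ : ContDiff ℝ 1 φ) :
    ∃ ψ : (Fin N → ℝ) → ℝ, ContDiff ℝ 1 ψ ∧ (∀ x, |ψ x| ≤ 3) ∧
      ∀ x, |φ x| ≤ 1 → ψ =ᶠ[nhds x] φ := by
  let b : ContDiffBump (0 : ℝ) := ⟨2, 3, by norm_num, by norm_num⟩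
  refine ⟨fun x => b (φ x) * φ x, (b.contDiff.comp hφ).mul hφ, fun x => ?_, fun x hx => ?_⟩
  · rw [abs_mul, abs_of_nonneg b.nonneg]
    rcases le_total 3 |φ x| with h | h
    · rw [b.zero_of_le_dist (by simpa using h)]
      simp
    · exact (mul_le_of_le_one_left (abs_nonneg _) b.le_one).trans h
  · have hmem : φ x ∈ Metric.ball (0 : ℝ) b.rIn := by
      have : |φ x| < 2 := by linarith
      simpa using this
    filter_upwards [hφ.continuous.continuousAt.eventually
      (b.eventuallyEq_one_of_mem_ball hmem)] with y hy
    rw [hy]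
    simp

theorem VvarN_map_smul_add_le (hN : 0 < N) {c α : ℝ} (hα : 0 < α) (hc : α ≤ |c|)
    (H : Fin N → ℝ)
    (hmaps : MapsTo (fun x => c • x + H)
      (univ.pi fun _ : Fin N => Icc (0:ℝ) 1) (univ.pi fun _ : Fin N => Icc (0:ℝ) 1))
    {μ : SignedMeasure (Fin N → ℝ)} (hμ : ConcOnCube μ) :
    VvarN (μ.map (fun x => c • x + H)) ≤ α⁻¹ * VvarN μ := by
  have hc0 : 0 < |c| := hα.trans_le hc
  have hcne : c ≠ 0 := abs_pos.1 hc0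
  have hε : |c * |c|⁻¹| = 1 := by
    rw [abs_mul, abs_inv, abs_abs, mul_inv_cancel₀ hc0.ne']
  have hε' : c⁻¹ * (c * |c|⁻¹) = |c|⁻¹ := inv_mul_cancel_left₀ hcne _
  set ε := c * |c|⁻¹
  have hεε : ε * ε = 1 := by rw [← abs_mul_abs_self, hε, one_mul]
  have fderiv_mul : ∀ (a : ℝ) {f : (Fin N → ℝ) → ℝ}, ContDiff ℝ 1 f → ∀ x v : Fin N → ℝ,
      fderiv ℝ (fun y => a * f y) x v = a * fderiv ℝ f x v := by
    intro a f hf x v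
    rw [fderiv_const_mul (hf.differentiable one_ne_zero x)]
    simp
  by_cases hbdd : BddAbove {y | ∃ i : Fin N, ∃ φ : (Fin N → ℝ) → ℝ, ContDiff ℝ 1 φ ∧
    (∀ x ∈ univ.pi fun _ : Fin N => Icc (0:ℝ) 1, |φ x| ≤ 1) ∧
    y = sIntN μ (fun x => fderiv ℝ φ x (Pi.single i 1))}
  · have hnonneg : 0 ≤ VvarN μ :=
      le_csSup hbdd ⟨⟨0, hN⟩, fun _ => 0, contDiff_const, by simp, by simp [sIntN]⟩
    refine Real.sSup_le ?_ (mul_nonneg (inv_nonneg.2 hα.le) hnonneg)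
    rintro y ⟨i, φ, hφ, hφ1, rfl⟩
    have hφT : ContDiff ℝ 1 (fun x => φ (c • x + H)) :=
      hφ.comp ((contDiff_id.const_smul c).add contDiff_const)
    have hz : sIntN μ (fun x => fderiv ℝ (fun y => ε * φ (c • y + H)) x (Pi.single i 1))
        ≤ VvarN μ := by
      refine le_csSup hbdd ⟨i, _, contDiff_const.mul hφT, fun x hx => ?_, rfl⟩
      rw [abs_mul, hε, one_mul]
      exact hφ1 _ (hmaps hx)
    simp only [fderiv_mul ε hφT, sIntN_const_mul] at hz
    rw [sIntN_map_smul_add μ hcne H _ hφ]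
    set I := sIntN μ (fun x => fderiv ℝ (fun y => φ (c • y + H)) x (Pi.single i 1))
    calc c⁻¹ * I = |c|⁻¹ * (ε * I) := by rw [← hε']; linear_combination (-(c⁻¹ * I)) * hεε
      _ ≤ |c|⁻¹ * VvarN μ := by gcongr
      _ ≤ α⁻¹ * VvarN μ := by gcongr
  · have hV : VvarN μ = 0 := Real.sSup_of_not_bddAbove hbdd
    rw [hV, mul_zero]
    refine (Real.sSup_of_not_bddAbove fun hb => hbdd ?_).le
    obtain ⟨M, hM⟩ := hb
    refine ⟨3 * |c| * M, ?_⟩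
    rintro z ⟨i, φ, hφ, hφ1, rfl⟩
    obtain ⟨ψ, hψ, hψ3, hψφ⟩ := exists_contDiff_bounded_eventuallyEq hφ
    have hψT : ContDiff ℝ 1 (fun x => ε / 3 * ψ (c⁻¹ • (x - H))) :=
      contDiff_const.mul (hψ.comp ((contDiff_id.sub contDiff_const).const_smul c⁻¹))
    have hle := hM ⟨i, _, hψT, fun x _ => by
      rw [abs_mul, abs_div, hε, abs_of_pos (by norm_num : (0:ℝ) < 3)]
      linarith [hψ3 (c⁻¹ • (x - H))], rfl⟩
    rw [sIntN_map_smul_add μ hcne H _ hψT] at hle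
    simp only [add_sub_cancel_right, inv_smul_smul₀ hcne, fderiv_mul _ hψ,
      sIntN_const_mul] at hle
    rw [hμ.sIntN_congr fun x hx => by rw [(hψφ x (hφ1 x hx)).fderiv_eq]] at hle
    set I := sIntN μ (fun x => fderiv ℝ φ x (Pi.single i 1))
    have heq : c⁻¹ * (ε / 3 * I) = |c|⁻¹ * (I / 3) := by rw [← hε']; ring
    rw [heq, inv_mul_le_iff₀ hc0] at hle
    linarith

end Cube

/-- A linear map expanding every norm by the factor `α` is a homothety of ratio at least `α`. -/
theorem exists_eq_smul_of_forall_norm_expanding {N : ℕ} (hN : 0 < N)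
    {G : Matrix (Fin N) (Fin N) ℝ} {α : ℝ} (hα : 0 < α)
    (hG : ∀ ℓ : (Fin N → ℝ) → ℝ,
      (∀ ξ η, ℓ (ξ + η) ≤ ℓ ξ + ℓ η) →
      (∀ (t : ℝ) ξ, ℓ (t • ξ) = |t| * ℓ ξ) →
      (∀ ξ, ℓ ξ = 0 → ξ = 0) →
      ∀ ξ, α * ℓ ξ ≤ ℓ (G.mulVec ξ)) :
    ∃ c : ℝ, α ≤ |c| ∧ ∀ ξ, G.mulVec ξ = c • ξ := by
  have hdep : ∀ v, ¬ LinearIndependent ℝ ![v, G.mulVecLin v] := by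
    intro v hv
    have hnot : v ∉ Submodule.span ℝ {G.mulVec v} := by
      intro hmem
      obtain ⟨a, ha⟩ := Submodule.mem_span_singleton.1 hmem
      refine one_ne_zero (α := ℝ) (LinearIndependent.pair_iff.1 hv 1 (-a) ?_).1
      simp [ha]
    obtain ⟨f, hfv, hf⟩ := Submodule.exists_le_ker_of_notMem hnot
    have hfG : f (G.mulVec v) = 0 := hf (Submodule.mem_span_singleton_self _)
    have key : ∀ δ : ℝ, 0 < δ → α * (|f v| + δ * ‖v‖) ≤ δ * ‖G.mulVec v‖ := by
      intro δ hδ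
      have := hG (fun x => |f x| + δ * ‖x‖) (fun ξ η => ?_) (fun t ξ => ?_) (fun ξ h => ?_) v
      · simpa [hfG] using this
      · have h1 := abs_add_le (f ξ) (f η)
        have h2 := mul_le_mul_of_nonneg_left (norm_add_le ξ η) hδ.le
        rw [map_add]
        linarith
      · rw [map_smul, smul_eq_mul, abs_mul, norm_smul, Real.norm_eq_abs]
        ring
      · have h1 : δ * ‖ξ‖ ≤ 0 := by linarith [abs_nonneg (f ξ)]
        exact norm_le_zero_iff.1 (nonpos_of_mul_nonpos_right h1 hδ)
    have hpos : 0 < α * |f v| := mul_pos hα (abs_pos.2 hfv)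
    have hδ : 0 < α * |f v| / (‖G.mulVec v‖ + 1) := by positivity
    have h := key _ hδ
    have hlt : α * |f v| / (‖G.mulVec v‖ + 1) * ‖G.mulVec v‖ < α * |f v| := by
      rw [div_mul_eq_mul_div, div_lt_iff₀ (by positivity)]
      nlinarith
    have : 0 ≤ α * (α * |f v| / (‖G.mulVec v‖ + 1) * ‖v‖) := by positivity
    linarith
  obtain ⟨c, hc⟩ := LinearMap.exists_eq_smul_id_of_forall_notLinearIndependent hdep
  have hGc : ∀ ξ, G.mulVec ξ = c • ξ := fun ξ => by
    simpa using congrArg (fun L => L ξ) hc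
  refine ⟨c, ?_, hGc⟩
  have h := hG norm norm_add_le (fun t ξ => by rw [norm_smul, Real.norm_eq_abs])
    (fun ξ => norm_eq_zero.1) (Pi.single ⟨0, hN⟩ 1)
  simpa [hGc, norm_smul] using h

/-- For an affine map `τ̄ x̄ = G x̄ + H` of the unit cube into itself satisfying
`ℓ(Gξ) ≥ α·ℓ(ξ)` for every norm `ℓ` on `ℝ^N`, the transfer operator contracts the
variation: `V̄(τ̄*μ̄) ≤ (1/α)·V̄(μ̄)`. -/
theorem variation_transfer_affine_contraction {N : ℕ} (hN : 0 < N)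
    (G : Matrix (Fin N) (Fin N) ℝ) (H : Fin N → ℝ) (α : ℝ) (hα : 0 < α)
    (hmaps : MapsTo (fun x => G.mulVec x + H)
      (univ.pi fun _ : Fin N => Icc (0:ℝ) 1) (univ.pi fun _ : Fin N => Icc (0:ℝ) 1))
    (hG : ∀ ℓ : (Fin N → ℝ) → ℝ,
      (∀ ξ η, ℓ (ξ + η) ≤ ℓ ξ + ℓ η) →
      (∀ (t : ℝ) ξ, ℓ (t • ξ) = |t| * ℓ ξ) →
      (∀ ξ, ℓ ξ = 0 → ξ = 0) →
      ∀ ξ, α * ℓ ξ ≤ ℓ (G.mulVec ξ))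
    (μ : SignedMeasure (Fin N → ℝ)) (hμ : ConcOnCube μ) :
    VvarN (μ.map (fun x => G.mulVec x + H)) ≤ α⁻¹ * VvarN μ := by
  obtain ⟨c, hc, hGc⟩ := exists_eq_smul_of_forall_norm_expanding hN hα hG
  simp only [hGc] at hmaps ⊢
  exact VvarN_map_smul_add_le hN hα hc H hmaps hμ
end

section
/- Let T : [0,1] → [0,1] be a λ-expanding map with λ > 1 and let τ : [0,1] → [0,1] be the piecewise-linear map equal to α_i x + c_i on each interval A_i = [a_i, a_i'] (with α_i > 0 and τ(A_i) ⊆ A_i) for i = 1, …, n, and equal to the identity outside A := ∪_i A_i. Assume 2·(n + 1 + Σ_{i=1}^n 1/α_i) < λ. Then the dynamical system (τ∘T, [0,1]) has an invariant Borel probability measure which is absolutely continuous with respect to Lebesgue measure. -/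
open MeasureTheory Set

/-- A `λ`-expanding map of `[0,1]`: a piecewise `C²`-smooth map, bijective on each element
`X_i = [b_i, b_{i+1}]` of a finite interval partition of `[0,1]`, with `|τ'| ≥ λ > 0`. -/
structure ExpandingMap (lam : ℝ) where
  /-- the map itself -/
  toFun : ℝ → ℝ
  lam_pos : 0 < lam
  /-- number of intervals of the partition -/
  n : ℕ
  npos : 0 < n
  /-- endpoints of the intervals of the partition -/
  b : ℕ → ℝ
  b_zero : b 0 = 0
  b_last : b n = 1
  b_lt : ∀ i < n, b i < b (i + 1)
  /-- the `C²`-smooth branches -/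
  f : ℕ → ℝ → ℝ
  f_smooth : ∀ i < n, ContDiff ℝ 2 (f i)
  eq_f : ∀ i < n, ∀ x ∈ Set.Ico (b i) (b (i + 1)), toFun x = f i x
  eq_f_one : toFun 1 = f (n - 1) 1
  maps : Set.MapsTo toFun (Set.Icc 0 1) (Set.Icc 0 1)
  inj : ∀ i < n, Set.InjOn (f i) (Set.Icc (b i) (b (i + 1)))
  expand : ∀ i < n, ∀ x ∈ Set.Icc (b i) (b (i + 1)), lam ≤ |deriv (f i) x|
  meas : Measurable toFun

/-- `β₁(τ) = 2/(λ·min_i |X_i|)`. -/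
noncomputable def ExpandingMap.beta1 {lam : ℝ} (E : ExpandingMap lam) : ℝ :=
  2 / (lam * sInf {y | ∃ i < E.n, y = E.b (i + 1) - E.b i})

/-- `β₂(τ) = sup_x |(1/τ'(x))'|`. -/
noncomputable def ExpandingMap.beta2 {lam : ℝ} (E : ExpandingMap lam) : ℝ :=
  sSup {y | ∃ i < E.n, ∃ x ∈ Set.Icc (E.b i) (E.b (i + 1)),
    y = |deriv (fun z => (deriv (E.f i) z)⁻¹) x|}

/-- `β(τ) = β₁(τ) + β₂(τ)`. -/
noncomputable def ExpandingMap.beta {lam : ℝ} (E : ExpandingMap lam) : ℝ :=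
  E.beta1 + E.beta2

/-- The piecewise-linear map of `[0,1]` equal to `α_i x + c_i` on each interval
`A_i = [a_i, a_i']` (with `α_i > 0` and `τ(A_i) ⊆ A_i`), and equal to the identity outside
`A = ∪_i A_i`. -/
structure PiecewiseLinearMap (n : ℕ) where
  npos : 0 < n
  /-- left endpoints of the intervals `A_i` -/
  a : Fin n → ℝ
  /-- right endpoints of the intervals `A_i` -/
  a' : Fin n → ℝ
  /-- slopes -/
  slope : Fin n → ℝ
  /-- intercepts -/
  c : Fin n → ℝ
  ha0 : ∀ i, 0 ≤ a i
  ha1 : ∀ i, a' i ≤ 1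
  hlt : ∀ i, a i < a' i
  hsep : ∀ i : Fin n, ∀ h : (i : ℕ) + 1 < n, a' i ≤ a ⟨(i : ℕ) + 1, h⟩
  slope_pos : ∀ i, 0 < slope i
  /-- the map itself -/
  toFun : ℝ → ℝ
  eqA : ∀ i, ∀ x ∈ Set.Icc (a i) (a' i), toFun x = slope i * x + c i
  eqId : ∀ x, x ∉ (⋃ i, Set.Icc (a i) (a' i)) → toFun x = x
  mapsA : ∀ i, Set.MapsTo toFun (Set.Icc (a i) (a' i)) (Set.Icc (a i) (a' i))
  meas : Measurable toFun


open Filter Topology in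
/-- Krylov–Bogolyubov for a dominated orbit of measures. -/
theorem exists_invariant_le_of_orbit_le {Ω : Type*} [MeasurableSpace Ω] {S : Ω → Ω}
    (hS : Measurable S) (μ : ℕ → Measure Ω) (ρ : Measure Ω) [IsFiniteMeasure ρ]
    (hprob : ∀ k, IsProbabilityMeasure (μ k)) (hle : ∀ k, μ k ≤ ρ)
    (hmap : ∀ k, μ (k + 1) = (μ k).map S) :
    ∃ ν : Measure Ω, IsProbabilityMeasure ν ∧ ν ≤ ρ ∧
      ∀ A, MeasurableSet A → ν (S ⁻¹' A) = ν A := by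
  classical
  let a : ℕ → Set Ω → ENNReal := fun N A => ((N : ENNReal) + 1)⁻¹ * ∑ k ∈ Finset.range (N + 1), μ k A
  have hN0 : ∀ N : ℕ, ((N : ENNReal) + 1) ≠ 0 := fun N => by simp
  have hNt : ∀ N : ℕ, ((N : ENNReal) + 1) ≠ ⊤ := fun N => by finiteness
  have ha_le : ∀ N A, a N A ≤ ρ A := by
    intro N A
    calc a N A ≤ ((N : ENNReal) + 1)⁻¹ * ∑ k ∈ Finset.range (N + 1), ρ A := by
          exact mul_le_mul_right (Finset.sum_le_sum fun k _ => hle k A) _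
      _ = ρ A := by
          rw [Finset.sum_const, Finset.card_range, nsmul_eq_mul, ← mul_assoc]
          push_cast
          rw [ENNReal.inv_mul_cancel (hN0 N) (hNt N), one_mul]
  have ha_add : ∀ N A B, Disjoint A B → MeasurableSet B → a N (A ∪ B) = a N A + a N B := by
    intro N A B hd hB
    simp only [a, ← mul_add, ← Finset.sum_add_distrib, measure_union hd hB]
  have ha_mono : ∀ N A B, A ⊆ B → a N A ≤ a N B := by
    intro N A B hAB
    simp only [a]
    gcongr
  let U : Ultrafilter ℕ := hyperfilter ℕ
  let m : Set Ω → ENNReal := fun A => (U.map (fun N => a N A)).lim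
  have hm : ∀ A, Tendsto (fun N => a N A) U (𝓝 (m A)) := fun A =>
    (U.map (fun N => a N A)).le_nhds_lim
  have hm_le : ∀ A, m A ≤ ρ A := fun A => le_of_tendsto' (hm A) fun N => ha_le N A
  have hm_mono : ∀ A B, A ⊆ B → m A ≤ m B := fun A B h =>
    le_of_tendsto_of_tendsto' (hm A) (hm B) fun N => ha_mono N A B h
  have hm_add : ∀ A B, Disjoint A B → MeasurableSet B → m (A ∪ B) = m A + m B := by
    intro A B hd hB
    refine tendsto_nhds_unique (hm _) ?_
    simp only [ha_add _ A B hd hB]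
    exact (hm A).add (hm B)
  have hm_empty : m ∅ = 0 := le_antisymm ((hm_le ∅).trans (by simp)) bot_le
  have hm_fin : ∀ (f : ℕ → Set Ω), (∀ i, MeasurableSet (f i)) → Pairwise (Function.onFun Disjoint f) →
      ∀ n, m (⋃ i ∈ Finset.range n, f i) = ∑ i ∈ Finset.range n, m (f i) := by
    intro f hf hd n
    induction n with
    | zero => simp [hm_empty]
    | succ n ih =>
      rw [Finset.sum_range_succ, ← ih, ← hm_add _ _ _ (hf n)]
      · congr 1
        rw [Finset.range_add_one, Finset.set_biUnion_insert, Set.union_comm]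
      · simp only [Set.disjoint_iUnion_left, Finset.mem_range]
        exact fun i hi => hd hi.ne
  let ν : Measure Ω := Measure.ofMeasurable (fun A _ => m A) hm_empty (by
    intro f hf hd
    have hρ : Tendsto (fun n => ∑' k, ρ (f (k + n))) atTop (𝓝 0) := by
      apply ENNReal.tendsto_sum_nat_add (fun i => ρ (f i))
      rw [← measure_iUnion hd hf]
      finiteness
    have hsum := ENNReal.tendsto_nat_tsum (fun i => m (f i))
    apply le_antisymm
    · have h1 : ∀ n, m (⋃ i, f i) ≤ ∑ i ∈ Finset.range n, m (f i) + ∑' k, ρ (f (k + n)) := by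
        intro n
        have hd2 : Pairwise (Function.onFun Disjoint fun k => f (k + n)) := fun i j hij =>
          hd (by omega)
        have hsub : (⋃ i, f i) ⊆ (⋃ i ∈ Finset.range n, f i) ∪ ⋃ k, f (k + n) := by
          intro x hx
          obtain ⟨i, hi⟩ := Set.mem_iUnion.1 hx
          by_cases hin : i < n
          · exact Or.inl (by simp only [Set.mem_iUnion, Finset.mem_range]; exact ⟨i, hin, hi⟩)
          · exact Or.inr (Set.mem_iUnion.2 ⟨i - n, by rwa [Nat.sub_add_cancel (by omega)]⟩)
        refine (hm_mono _ _ hsub).trans ?_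
        rw [hm_add _ _ _ (MeasurableSet.iUnion fun k => hf _), hm_fin f hf hd,
          ← measure_iUnion hd2 fun k => hf _]
        · gcongr
          exact hm_le _
        · simp only [Set.disjoint_iUnion_left, Set.disjoint_iUnion_right, Finset.mem_range]
          exact fun i j hj => hd (by omega)
      have := ge_of_tendsto' (hsum.add hρ) h1
      simpa using this
    · refine le_of_tendsto' hsum fun n => ?_
      rw [← hm_fin f hf hd]
      exact hm_mono _ _ (by simp only [Set.iUnion_subset_iff]; exact fun i _ => subset_iUnion f i))
  have hν : ∀ A, MeasurableSet A → ν A = m A := fun A hA => Measure.ofMeasurable_apply A hA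
  refine ⟨ν, ⟨?_⟩, ?_, ?_⟩
  · rw [hν _ MeasurableSet.univ]
    refine tendsto_nhds_unique (hm _) ?_
    have : ∀ N, a N univ = 1 := by
      intro N
      simp only [a, measure_univ, Finset.sum_const, Finset.card_range, nsmul_eq_mul, mul_one]
      push_cast
      exact ENNReal.inv_mul_cancel (hN0 N) (hNt N)
    simp only [this]
    exact tendsto_const_nhds
  · exact Measure.le_iff.2 fun A hA => (hν A hA).trans_le (hm_le A)
  · intro A hA
    rw [hν A hA, hν _ (hS hA)]
    have hkey : ∀ N, a N (S ⁻¹' A) + ((N : ENNReal) + 1)⁻¹ * μ 0 A =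
        a N A + ((N : ENNReal) + 1)⁻¹ * μ (N + 1) A := by
      intro N
      have : ∀ k, μ k (S ⁻¹' A) = μ (k + 1) A := fun k => by rw [hmap, Measure.map_apply hS hA]
      simp only [a, this, ← mul_add]
      rw [← Finset.sum_range_succ' (fun k => μ k A), ← Finset.sum_range_succ (fun k => μ k A)]
    have hinv : Tendsto (fun N : ℕ => ((N : ENNReal) + 1)⁻¹) U (𝓝 0) := by
      have : Tendsto (fun N : ℕ => ((N + 1 : ℕ) : ENNReal)⁻¹) atTop (𝓝 0) :=
        ENNReal.tendsto_inv_nat_nhds_zero.comp (tendsto_add_atTop_nat 1)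
      push_cast at this
      exact this.mono_left (Nat.hyperfilter_le_atTop)
    have hz : ∀ j : ℕ → ℕ, Tendsto (fun N : ℕ => ((N : ENNReal) + 1)⁻¹ * μ (j N) A) U (𝓝 0) :=
      fun j => tendsto_of_tendsto_of_tendsto_of_le_of_le tendsto_const_nhds hinv
        (fun _ => bot_le) fun N => mul_le_of_le_one_right' prob_le_one
    have h1 := (hm (S ⁻¹' A)).add (hz fun _ => 0)
    have h2 := (hm A).add (hz fun N => N + 1)
    simp only [hkey] at h1
    simpa using tendsto_nhds_unique h1 h2


/-- `μ` integrates the derivative of every test function bounded by `M` to at most `V * M`: a dual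
form of the statement that the density of `μ` has total variation at most `V`. -/
def VariationBound (μ : Measure ℝ) (V : ℝ) : Prop :=
  ∀ (φ h : ℝ → ℝ) (D : Set ℝ) (M H : ℝ), Continuous φ → Measurable h → D.Countable →
    (∀ x, |φ x| ≤ M) → (∀ x, |h x| ≤ H) → (∀ x ∉ D, HasDerivAt φ (h x) x) →
    |∫ x, h x ∂μ| ≤ V * M

theorem variationBound_volume_restrict_Icc :
    VariationBound ((volume : Measure ℝ).restrict (Icc 0 1)) 2 := by
  intro φ h D M H hφ hh hD hM hH hd
  have hi : IntervalIntegrable h volume 0 1 := by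
    rw [intervalIntegrable_iff]
    exact Measure.integrableOn_of_bounded (M := H) (by simp) hh.aestronglyMeasurable
      (Filter.Eventually.of_forall hH)
  have := integral_eq_of_hasDerivAt_off_countable φ h hD hφ.continuousOn
    (fun x hx => hd x hx.2) hi
  rw [integral_Icc_eq_integral_Ioc, ← intervalIntegral.integral_of_le zero_le_one, this]
  have h0 := abs_le.1 (hM 0)
  have h1 := abs_le.1 (hM 1)
  rw [abs_le]
  constructor <;> linarith

theorem VariationBound.le_smul_volume {μ : Measure ℝ} [IsFiniteMeasure μ] {V : ℝ}
    (hμ : VariationBound μ V) (hV : 0 < V) :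
    μ ≤ ENNReal.ofReal V • (volume : Measure ℝ) := by
  have hIoc : ∀ p q : ℝ, p ≤ q → μ (Ioc p q) ≤ ENNReal.ofReal V * ENNReal.ofReal (q - p) := by
    intro p q hpq
    have key := hμ (fun x => max 0 (min (x - p) (q - p))) ((Ioc p q).indicator 1) {p, q} (q - p) 1
      (by fun_prop) (measurable_one.indicator measurableSet_Ioc) (by simp)
      (fun x => by
        rw [abs_of_nonneg (le_max_left _ _)]
        exact max_le (by linarith) (min_le_right _ _))
      (fun x => by by_cases hx : x ∈ Ioc p q <;> simp [hx])
      (by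
        intro x hx
        simp only [mem_insert_iff, mem_singleton_iff, not_or] at hx
        rcases lt_or_gt_of_ne hx.1 with h1 | h1
        · rw [indicator_of_notMem (by simp [h1.le])]
          refine (hasDerivAt_const x (0 : ℝ)).congr_of_eventuallyEq ?_
          filter_upwards [Iio_mem_nhds h1] with y hy
          exact max_eq_left ((min_le_left _ _).trans (by linarith [mem_Iio.1 hy]))
        rcases lt_or_gt_of_ne hx.2 with h2 | h2
        · rw [indicator_of_mem (show x ∈ Ioc p q from ⟨h1, h2.le⟩)]
          refine ((hasDerivAt_id x).sub_const p).congr_of_eventuallyEq ?_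
          filter_upwards [Ioo_mem_nhds h1 h2] with y hy
          simp only [id]
          rw [min_eq_left (by linarith [hy.2]), max_eq_right (by linarith [hy.1])]
        · rw [indicator_of_notMem (by simp [h2])]
          refine (hasDerivAt_const x (q - p)).congr_of_eventuallyEq ?_
          filter_upwards [Ioi_mem_nhds h2] with y hy
          rw [min_eq_right (by linarith [mem_Ioi.1 hy]), max_eq_right (by linarith)])
    rw [integral_indicator_one measurableSet_Ioc, abs_of_nonneg measureReal_nonneg] at key
    rw [← ENNReal.ofReal_mul hV.le, ← ofReal_measureReal]
    exact ENNReal.ofReal_le_ofReal key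
  have hV0 : ENNReal.ofReal V ≠ 0 := by simpa using hV
  have hVt : ENNReal.ofReal V ≠ ⊤ := ENNReal.ofReal_ne_top
  refine Measure.le_iff.2 fun A hA => ?_
  have h1 : ((ENNReal.ofReal V)⁻¹ • μ).toOuterMeasure ≤ StieltjesFunction.id.outer := by
    refine (OuterMeasure.le_ofFunction (m_empty := StieltjesFunction.id.length_empty)).2 fun s => ?_
    rw [StieltjesFunction.length_eq]
    refine le_iInf₂ fun p q => le_iInf fun hs => ?_
    rw [show botSet (R := ℝ) = ∅ by
      ext x; simp [botSet], sdiff_empty] at hs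
    change (ENNReal.ofReal V)⁻¹ * μ s ≤ _
    rw [ENNReal.inv_mul_le_iff hV0 hVt]
    rcases le_total p q with hpq | hpq
    · exact (measure_mono hs).trans (hIoc p q hpq)
    · rw [Ioc_eq_empty (not_lt.2 hpq)] at hs
      simp [subset_empty_iff.1 hs]
  have h2 := h1 A
  change (ENNReal.ofReal V)⁻¹ * μ A ≤ _ at h2
  rw [ENNReal.inv_mul_le_iff hV0 hVt] at h2
  rwa [Real.volume_eq_stieltjes_id, StieltjesFunction.measure_def]


theorem exists_branch_test_function {p q s : ℝ} (hpq : p < q) (hs : 0 < s) {F : ℝ → ℝ}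
    (hF : ContDiff ℝ 2 F) (hinj : InjOn F (Icc p q)) (hexp : ∀ x ∈ Icc p q, s ≤ |deriv F x|) :
    ∃ C : ℝ, 0 ≤ C ∧ ∀ (φ h : ℝ → ℝ) (D : Set ℝ) (M H : ℝ), Continuous φ → Measurable h →
      D.Countable → (∀ x, |φ x| ≤ M) → (∀ x, |h x| ≤ H) → (∀ x ∉ D, HasDerivAt φ (h x) x) →
      ∃ (ψ k : ℝ → ℝ) (D' : Set ℝ) (H' : ℝ), Continuous ψ ∧ Measurable k ∧ D'.Countable ∧
        (∀ x, |ψ x| ≤ 2 / s * M) ∧ (∀ x, |k x| ≤ H') ∧ (∀ x ∉ D', HasDerivAt ψ (k x) x) ∧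
        (∀ x ∉ Ioo p q, ψ x = 0) ∧ (∀ x ∉ Ioo p q, k x = 0) ∧
        ∀ x ∈ Ioo p q, |h (F x) - k x| ≤ C * M := by
  have hF' : ContDiff ℝ 1 (deriv F) := ContDiff.deriv' (n := 1) (hF.of_le (by norm_num))
  have hne : ∀ x ∈ Icc p q, deriv F x ≠ 0 := fun x hx h0 => by
    have := hexp x hx
    rw [h0, abs_zero] at this
    linarith
  set r : ℝ → ℝ := fun x => (deriv F x)⁻¹ with hr
  have hrd : ∀ x ∈ Icc p q, HasDerivAt r (-deriv (deriv F) x / deriv F x ^ 2) x := fun x hx =>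
    (hF'.differentiable (by norm_num) x).hasDerivAt.inv (hne x hx)
  have hrle : ∀ x ∈ Icc p q, |r x| ≤ 1 / s := fun x hx => by
    rw [hr, abs_inv, one_div]
    exact inv_anti₀ hs (hexp x hx)
  have hr'c : ContinuousOn (deriv r) (Icc p q) := by
    refine ContinuousOn.congr (f := fun x => -deriv (deriv F) x / deriv F x ^ 2) ?_
      fun x hx => (hrd x hx).deriv
    refine ContinuousOn.div ?_ ?_ fun x hx => pow_ne_zero 2 (hne x hx)
    · exact (hF'.continuous_deriv le_rfl).neg.continuousOn
    · exact (hF'.continuous.pow 2).continuousOn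
  obtain ⟨B, hB⟩ := isCompact_Icc.exists_bound_of_continuousOn hr'c
  simp only [Real.norm_eq_abs] at hB
  have hB0 : 0 ≤ B := (abs_nonneg _).trans (hB p (left_mem_Icc.2 hpq.le))
  have hqp : 0 < q - p := sub_pos.2 hpq
  refine ⟨B + 2 / s / (q - p), by positivity, ?_⟩
  intro φ h D M H hφ hh hD hM hH hd
  have hM0 : 0 ≤ M := (abs_nonneg _).trans (hM 0)
  set g : ℝ → ℝ := fun x => φ (F x) * r x with hg
  have hgle : ∀ x ∈ Icc p q, |g x| ≤ M / s := fun x hx => by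
    rw [hg, abs_mul, div_eq_mul_one_div]
    exact mul_le_mul (hM _) (hrle x hx) (abs_nonneg _) hM0
  have hgc : ContinuousOn g (Icc p q) :=
    (hφ.comp hF.continuous).continuousOn.mul fun x hx => (hrd x hx).continuousAt.continuousWithinAt
  set m : ℝ := (g q - g p) / (q - p) with hm
  have hgp := abs_le.1 (hgle p (left_mem_Icc.2 hpq.le))
  have hgq := abs_le.1 (hgle q (right_mem_Icc.2 hpq.le))
  have hmle : |m| ≤ 2 / s / (q - p) * M := by
    rw [hm, abs_div, abs_of_pos hqp, div_mul_eq_mul_div]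
    gcongr
    rw [div_mul_eq_mul_div, mul_div_assoc, abs_le]
    constructor <;> linarith
  set ψ₀ : ℝ → ℝ := fun x => g x - g p - m * (x - p) with hψ₀
  have hψ₀le : ∀ x ∈ Icc p q, |ψ₀ x| ≤ 2 / s * M := fun x hx => by
    have hgx := abs_le.1 (hgle x hx)
    have e : g p + m * (x - p) = ((q - x) * g p + (x - p) * g q) / (q - p) := by
      rw [hm]; field_simp; ring
    have l1 : g p + m * (x - p) ≤ M / s := by
      rw [e, div_le_iff₀ hqp]
      nlinarith [mul_le_mul_of_nonneg_left hgp.2 (sub_nonneg.2 hx.2),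
        mul_le_mul_of_nonneg_left hgq.2 (sub_nonneg.2 hx.1)]
    have l2 : -(M / s) ≤ g p + m * (x - p) := by
      rw [e, le_div_iff₀ hqp]
      nlinarith [mul_le_mul_of_nonneg_left hgp.1 (sub_nonneg.2 hx.2),
        mul_le_mul_of_nonneg_left hgq.1 (sub_nonneg.2 hx.1)]
    rw [hψ₀, div_mul_eq_mul_div, mul_div_assoc, abs_le]
    constructor <;> linarith
  have hψ₀c : ContinuousOn ψ₀ (Icc p q) := by
    refine (hgc.sub continuousOn_const).sub (Continuous.continuousOn ?_)
    fun_prop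
  have hψ₀p : ψ₀ p = 0 := by simp [hψ₀]
  have hψ₀q : ψ₀ q = 0 := by
    simp only [hψ₀, hm]; field_simp; ring
  have hproj : ∀ x, max p (min q x) ∈ Icc p q := fun x =>
    ⟨le_max_left _ _, max_le hpq.le (min_le_left _ _)⟩
  set k₀ : ℝ → ℝ := fun x => h (F x) + φ (F x) * deriv r x - m with hk₀
  have hleft : ∀ x ≤ p, ψ₀ (max p (min q x)) = 0 := fun x hx => by
    rw [min_eq_right (hx.trans hpq.le), max_eq_left hx, hψ₀p]
  have hright : ∀ x, q ≤ x → ψ₀ (max p (min q x)) = 0 := fun x hx => by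
    rw [min_eq_left hx, max_eq_right hpq.le, hψ₀q]
  refine ⟨fun x => ψ₀ (max p (min q x)), (Ioo p q).indicator k₀, {p, q} ∪ (Icc p q ∩ F ⁻¹' D),
    H + M * B + |m|, ?_, ?_, ?_, ?_, ?_, ?_, ?_, ?_, ?_⟩
  · exact hψ₀c.comp_continuous (by fun_prop) hproj
  · refine Measurable.indicator ?_ measurableSet_Ioo
    have := hF.continuous.measurable
    have := hφ.measurable
    have := measurable_deriv r
    fun_prop
  · refine Set.Countable.union (by simp) ?_
    refine MapsTo.countable_of_injOn (f := F) (t := D) (fun x hx => hx.2)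
      (hinj.mono inter_subset_left) hD
  · exact fun x => hψ₀le _ (hproj x)
  · intro x
    by_cases hx : x ∈ Ioo p q
    · rw [indicator_of_mem hx]
      have h1 : |φ (F x) * deriv r x| ≤ M * B := by
        rw [abs_mul]
        exact mul_le_mul (hM _) (hB x (Ioo_subset_Icc_self hx)) (abs_nonneg _) hM0
      exact (abs_sub _ _).trans (add_le_add ((abs_add_le _ _).trans (add_le_add (hH _) h1)) le_rfl)
    · rw [indicator_of_notMem hx, abs_zero]
      have := (abs_nonneg _).trans (hH 0)
      positivity
  · intro x hx
    simp only [mem_union, mem_insert_iff, mem_singleton_iff, not_or] at hx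
    obtain ⟨⟨hxp, hxq⟩, hxD⟩ := hx
    rcases lt_or_gt_of_ne hxp with h1 | h1
    · rw [indicator_of_notMem (by simp [h1.le])]
      refine (hasDerivAt_const x (0 : ℝ)).congr_of_eventuallyEq ?_
      filter_upwards [Iio_mem_nhds h1] with y hy
      exact hleft y (le_of_lt hy)
    rcases lt_or_gt_of_ne hxq with h2 | h2
    · have hxI : x ∈ Icc p q := ⟨h1.le, h2.le⟩
      rw [indicator_of_mem (show x ∈ Ioo p q from ⟨h1, h2⟩)]
      have hFx := (hF.differentiable (by norm_num) x).hasDerivAt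
      have hgx := ((hd (F x) fun hx => hxD ⟨hxI, hx⟩).comp x hFx).mul (hrd x hxI).differentiableAt.hasDerivAt
      have := (hgx.sub_const (g p)).sub (((hasDerivAt_id x).sub_const p).const_mul m)
      refine HasDerivAt.congr_deriv (HasDerivAt.congr_of_eventuallyEq this ?_) ?_
      · filter_upwards [Ioo_mem_nhds h1 h2] with y hy
        rw [min_eq_right hy.2.le, max_eq_right hy.1.le]
        simp [hψ₀, hg]
      · have : r x * deriv F x = 1 := inv_mul_cancel₀ (hne x hxI)
        simp only [hk₀, Function.comp]
        linear_combination h (F x) * this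
    · rw [indicator_of_notMem (by simp [h2.le])]
      refine (hasDerivAt_const x (0 : ℝ)).congr_of_eventuallyEq ?_
      filter_upwards [Ioi_mem_nhds h2] with y hy
      exact hright y (le_of_lt hy)
  · intro x hx
    rcases le_or_gt x p with h1 | h1
    · exact hleft x h1
    · exact hright x (not_lt.1 fun h2 => hx ⟨h1, h2⟩)
  · exact fun x hx => indicator_of_notMem hx _
  · intro x hx
    rw [indicator_of_mem hx, hk₀]
    have h1 : |φ (F x) * deriv r x| ≤ B * M := by
      rw [abs_mul, mul_comm]
      exact mul_le_mul (hB x (Ioo_subset_Icc_self hx)) (hM _) (abs_nonneg _) hB0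
    rw [show h (F x) - (h (F x) + φ (F x) * deriv r x - m) = m - φ (F x) * deriv r x by ring,
      add_mul]
    linarith [abs_sub m (φ (F x) * deriv r x)]

theorem VariationBound.exists_map_bound {S : ℝ → ℝ} (hS : Measurable S) {G : Finset (ℝ × ℝ)}
    (hG : ∀ e ∈ G, e.1 < e.2) (hdisj : ∀ e ∈ G, ∀ e' ∈ G, ∀ x ∈ Ioo e.1 e.2, x ∈ Ioo e'.1 e'.2 → e = e')
    {s : ℝ} (hs : 0 < s)
    (hbranch : ∀ e ∈ G, ∃ F : ℝ → ℝ, ContDiff ℝ 2 F ∧ InjOn F (Icc e.1 e.2) ∧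
      (∀ x ∈ Icc e.1 e.2, s ≤ |deriv F x|) ∧ ∀ x ∈ Ioo e.1 e.2, S x = F x) :
    ∃ C : ℝ, 0 ≤ C ∧ ∀ (μ : Measure ℝ) (V : ℝ), IsProbabilityMeasure μ → 0 ≤ V →
      (∀ᵐ x ∂μ, ∃ e ∈ G, x ∈ Ioo e.1 e.2) → VariationBound μ V →
      VariationBound (μ.map S) (2 / s * V + C) := by
  choose! F hF hinj hexp hSF using hbranch
  have hb := fun e he => exists_branch_test_function (hG e he) hs (hF e he) (hinj e he) (hexp e he)
  choose! C hC0 hC using hb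
  refine ⟨∑ e ∈ G, C e, Finset.sum_nonneg hC0, ?_⟩
  intro μ V _ hV hae hμ φ h D M H hφ hh hD hM hH hd
  have hM0 : 0 ≤ M := (abs_nonneg _).trans (hM 0)
  have hb := fun e he => hC e he φ h D M H hφ hh hD hM hH hd
  choose! ψ k D' H' hψc hkm hD' hψle hkle hψd hψ0 hk0 hhk using hb
  have hsum : ∀ u : ℝ × ℝ → ℝ → ℝ, (∀ e ∈ G, ∀ x ∉ Ioo e.1 e.2, u e x = 0) →
      ∀ e ∈ G, ∀ x ∈ Ioo e.1 e.2, ∑ e ∈ G, u e x = u e x := fun u hu e he x hx =>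
    Finset.sum_eq_single_of_mem e he fun e' he' hne => hu e' he' x fun hx' =>
      hne (hdisj e' he' e he x hx' hx)
  have hkb : ∀ x, |∑ e ∈ G, k e x| ≤ ∑ e ∈ G, H' e := fun x =>
    (Finset.abs_sum_le_sum_abs _ _).trans (Finset.sum_le_sum fun e he => hkle e he x)
  have hkmeas : Measurable fun x => ∑ e ∈ G, k e x := Finset.measurable_sum _ hkm
  have key := hμ (fun x => ∑ e ∈ G, ψ e x) (fun x => ∑ e ∈ G, k e x) (⋃ e ∈ G, D' e) (2 / s * M)
    (∑ e ∈ G, H' e) (continuous_finsetSum _ hψc) hkmeas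
    (G.countable_toSet.biUnion hD')
    (fun x => by
      by_cases hx : ∃ e ∈ G, x ∈ Ioo e.1 e.2
      · obtain ⟨e, he, hx⟩ := hx
        rw [hsum ψ hψ0 e he x hx]
        exact hψle e he x
      · push Not at hx
        rw [Finset.sum_eq_zero fun e he => hψ0 e he x (hx e he), abs_zero]
        positivity)
    hkb
    (fun x hx => by
      simp only [mem_iUnion, not_exists] at hx
      exact HasDerivAt.fun_sum fun e he => hψd e he x (hx e he))
  have hint_h : Integrable (fun x => h (S x)) μ :=
    Integrable.of_bound (hh.comp hS).aestronglyMeasurable H (Filter.Eventually.of_forall fun x => hH _)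
  have hint_k : Integrable (fun x => ∑ e ∈ G, k e x) μ :=
    Integrable.of_bound hkmeas.aestronglyMeasurable _ (Filter.Eventually.of_forall hkb)
  have hdiff : |∫ x, (h (S x) - ∑ e ∈ G, k e x) ∂μ| ≤ (∑ e ∈ G, C e) * M := by
    have := norm_integral_le_of_norm_le_const (μ := μ)
      (f := fun x => h (S x) - ∑ e ∈ G, k e x) (C := (∑ e ∈ G, C e) * M) (by
        filter_upwards [hae] with x hx
        obtain ⟨e, he, hx⟩ := hx
        rw [hsum k hk0 e he x hx, hSF e he x hx]
        refine (hhk e he x hx).trans ?_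
        gcongr
        exact Finset.single_le_sum hC0 he)
    simpa using this
  rw [integral_map hS.aemeasurable hh.aestronglyMeasurable]
  rw [integral_sub hint_h hint_k] at hdiff
  have := abs_sub_abs_le_abs_sub (∫ x, h (S x) ∂μ) (∫ x, ∑ e ∈ G, k e x ∂μ)
  calc |∫ x, h (S x) ∂μ| ≤ V * (2 / s * M) + (∑ e ∈ G, C e) * M := by linarith
    _ = _ := by ring

/-- Lasota–Yorke theorem for maps that are piecewise `C²` off a finite set `Z` of break points. -/
theorem exists_acim_of_piecewise_expanding {S : ℝ → ℝ} (hS : Measurable S)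
    (hmaps : MapsTo S (Icc 0 1) (Icc 0 1)) {Z : Finset ℝ} (hZ0 : 0 ∈ Z) (hZ1 : 1 ∈ Z)
    {s : ℝ} (hs : 2 < s)
    (hbranch : ∀ p ∈ Z, ∀ q ∈ Z, p < q → (∀ z ∈ Z, z ∉ Ioo p q) →
      ∃ F : ℝ → ℝ, ContDiff ℝ 2 F ∧ InjOn F (Icc p q) ∧
      (∀ x ∈ Icc p q, s ≤ |deriv F x|) ∧ ∀ x ∈ Ioo p q, S x = F x) :
    ∃ μ : Measure ℝ, IsProbabilityMeasure μ ∧ μ (Icc (0:ℝ) 1) = 1 ∧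
      (∀ A : Set ℝ, MeasurableSet A → μ (S ⁻¹' A) = μ A) ∧ μ ≪ volume := by
  classical
  let G : Finset (ℝ × ℝ) := (Z ×ˢ Z).filter fun e => e.1 < e.2 ∧ ∀ z ∈ Z, z ∉ Ioo e.1 e.2
  have hGmem : ∀ e ∈ G, e.1 ∈ Z ∧ e.2 ∈ Z ∧ e.1 < e.2 ∧ ∀ z ∈ Z, z ∉ Ioo e.1 e.2 := by
    intro e he
    simpa [G, and_assoc] using he
  have hle : ∀ e ∈ G, ∀ e' ∈ G, ∀ x ∈ Ioo e.1 e.2, x ∈ Ioo e'.1 e'.2 → e.1 ≤ e'.1 ∧ e'.2 ≤ e.2 := by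
    intro e he e' he' x hx hx'
    obtain ⟨h1, h2, -, -⟩ := hGmem e he
    obtain ⟨-, -, -, h⟩ := hGmem e' he'
    constructor
    · exact not_lt.1 fun hlt => h _ h1 ⟨hlt, hx.1.trans hx'.2⟩
    · exact not_lt.1 fun hlt => h _ h2 ⟨hx'.1.trans hx.2, hlt⟩
  have hcover : ∀ x ∈ Icc (0 : ℝ) 1, x ∉ Z → ∃ e ∈ G, x ∈ Ioo e.1 e.2 := by
    intro x hx hxZ
    have hlow : (Z.filter (· ≤ x)).Nonempty := ⟨0, by simp [hZ0, hx.1]⟩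
    have hupp : (Z.filter (x ≤ ·)).Nonempty := ⟨1, by simp [hZ1, hx.2]⟩
    have hp := Finset.mem_filter.1 ((Z.filter (· ≤ x)).max'_mem hlow)
    have hq := Finset.mem_filter.1 ((Z.filter (x ≤ ·)).min'_mem hupp)
    set p := (Z.filter (· ≤ x)).max' hlow with hpdef
    set q := (Z.filter (x ≤ ·)).min' hupp with hqdef
    have hpx : p < x := lt_of_le_of_ne hp.2 fun h => hxZ (h ▸ hp.1)
    have hxq : x < q := lt_of_le_of_ne hq.2 fun h => hxZ (h ▸ hq.1)
    refine ⟨(p, q), ?_, hpx, hxq⟩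
    simp only [G, Finset.mem_filter, Finset.mem_product]
    refine ⟨⟨hp.1, hq.1⟩, hpx.trans hxq, fun z hz hzI => ?_⟩
    rcases le_total z x with h | h
    · exact absurd hzI.1 (not_lt.2 (Finset.le_max' _ _ (by simp [hz, h])))
    · exact absurd hzI.2 (not_lt.2 (Finset.min'_le _ _ (by simp [hz, h])))
  have hs0 : 0 < s := by linarith
  obtain ⟨C, hC0, hC⟩ := VariationBound.exists_map_bound hS (G := G) (fun e he => (hGmem e he).2.2.1)
    (fun e he e' he' x hx hx' => Prod.ext
      (le_antisymm (hle e he e' he' x hx hx').1 (hle e' he' e he x hx' hx).1)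
      (le_antisymm (hle e' he' e he x hx' hx).2 (hle e he e' he' x hx hx').2)) hs0
    (fun e he => hbranch e.1 (hGmem e he).1 e.2 (hGmem e he).2.1 (hGmem e he).2.2.1
      (hGmem e he).2.2.2)
  set θ : ℝ := 2 / s with hθ
  have hθ0 : 0 < θ := by positivity
  have hθ1 : θ < 1 := by rw [hθ, div_lt_one hs0]; exact hs
  set V : ℝ := 2 + C / (1 - θ) with hVdef
  have h1θ : 0 < 1 - θ := sub_pos.2 hθ1
  have hV : 2 ≤ V := le_add_of_nonneg_right (by positivity)
  have hVstep : θ * V + C ≤ V := by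
    have : C / (1 - θ) * (1 - θ) = C := div_mul_cancel₀ _ h1θ.ne'
    rw [hVdef]; nlinarith
  have hmono : ∀ (μ : Measure ℝ) (V₁ V₂ : ℝ), V₁ ≤ V₂ → VariationBound μ V₁ → VariationBound μ V₂ := by
    intro μ V₁ V₂ hV h φ f D M H h1 h2 h3 h4 h5 h6
    exact (h φ f D M H h1 h2 h3 h4 h5 h6).trans
      (mul_le_mul_of_nonneg_right hV ((abs_nonneg _).trans (h4 0)))
  let μ : ℕ → Measure ℝ := fun k =>
    (fun ν => ν.map S)^[k] ((volume : Measure ℝ).restrict (Icc 0 1))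
  have hμ_succ : ∀ k, μ (k + 1) = (μ k).map S := fun k => Function.iterate_succ_apply' _ _ _
  have hμ : ∀ k, IsProbabilityMeasure (μ k) ∧ (∀ᵐ x ∂(μ k), x ∈ Icc (0 : ℝ) 1) ∧
      VariationBound (μ k) V := by
    intro k
    induction k with
    | zero =>
      refine ⟨⟨?_⟩, ae_restrict_mem measurableSet_Icc,
        hmono _ _ _ hV variationBound_volume_restrict_Icc⟩
      simp [μ]
    | succ k ih =>
      obtain ⟨h1, h2, h3⟩ := ih
      rw [hμ_succ]
      refine ⟨Measure.isProbabilityMeasure_map hS.aemeasurable, ?_, hmono _ _ _ hVstep ?_⟩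
      · refine (ae_map_iff hS.aemeasurable measurableSet_Icc).2 ?_
        filter_upwards [h2] with x hx using hmaps hx
      · refine hC (μ k) V h1 (by linarith) ?_ h3
        have hVle : μ k ≤ ENNReal.ofReal V • volume := h3.le_smul_volume (by linarith)
        have hac : μ k ≪ volume :=
          (Measure.absolutelyContinuous_of_le hVle).trans Measure.smul_absolutelyContinuous
        have hZ : ∀ᵐ x ∂(μ k), x ∉ (Z : Set ℝ) :=
          hac.ae_le (measure_eq_zero_iff_ae_notMem.1 (Z.finite_toSet.measure_zero volume))
        filter_upwards [h2, hZ] with x hx hxZ using hcover x hx hxZ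
  have hρle : ∀ k, μ k ≤ (ENNReal.ofReal V • (volume : Measure ℝ)).restrict (Icc 0 1) := by
    intro k
    obtain ⟨h1, h2, h3⟩ := hμ k
    rw [← Measure.restrict_eq_self_of_ae_mem h2]
    exact Measure.restrict_mono le_rfl (h3.le_smul_volume (by linarith))
  have : IsFiniteMeasure ((ENNReal.ofReal V • (volume : Measure ℝ)).restrict (Icc 0 1)) := by
    constructor
    simp
  obtain ⟨ν, hν1, hν2, hν3⟩ := exists_invariant_le_of_orbit_le hS μ _ (fun k => (hμ k).1) hρle
    hμ_succ
  refine ⟨ν, hν1, ?_, hν3, ?_⟩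
  · rw [prob_compl_eq_zero_iff measurableSet_Icc |>.symm]
    refine le_antisymm ((hν2 _).trans ?_) bot_le
    rw [Measure.restrict_apply measurableSet_Icc.compl]
    simp
  · exact (Measure.absolutelyContinuous_of_le (hν2.trans Measure.restrict_le_self)).trans
      Measure.smul_absolutelyContinuous

theorem ExpandingMap.monotoneOn_b {lam : ℝ} (E : ExpandingMap lam) {i j : ℕ} (hij : i ≤ j)
    (hj : j ≤ E.n) : E.b i ≤ E.b j := by
  induction j, hij using Nat.le_induction with
  | base => exact le_rfl
  | succ j _ ih => exact (ih (by omega)).trans (E.b_lt j (by omega)).le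

theorem ExpandingMap.exists_mem_Ico {lam : ℝ} (E : ExpandingMap lam) {x : ℝ} (hx : x ∈ Ico (0 : ℝ) 1) :
    ∃ i < E.n, x ∈ Ico (E.b i) (E.b (i + 1)) := by
  have h : ∀ m, x < E.b m → ∃ i < m, x ∈ Ico (E.b i) (E.b (i + 1)) := by
    intro m
    induction m with
    | zero => intro h; exact absurd hx.1 (not_le.2 (by rwa [E.b_zero] at h))
    | succ m ih =>
      intro h
      rcases lt_or_ge x (E.b m) with h' | h'
      · obtain ⟨i, hi, hxi⟩ := ih h'
        exact ⟨i, by omega, hxi⟩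
      · exact ⟨m, by omega, h', h⟩
  exact h _ (by rw [E.b_last]; exact hx.2)

theorem PiecewiseLinearMap.mapsTo_Icc {n : ℕ} (P : PiecewiseLinearMap n) :
    MapsTo P.toFun (Icc 0 1) (Icc 0 1) := by
  intro x hx
  by_cases h : x ∈ ⋃ i, Icc (P.a i) (P.a' i)
  · obtain ⟨i, hi⟩ := mem_iUnion.1 h
    have := P.mapsA i hi
    exact ⟨(P.ha0 i).trans this.1, this.2.trans (P.ha1 i)⟩
  · rwa [P.eqId x h]

theorem mapsTo_Ioo_Icc_of_avoids_endpoints {f : ℝ → ℝ} {p q x₀ a a' : ℝ}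
    (hf : ContinuousOn f (Ioo p q))
    (hx₀ : x₀ ∈ Ioo p q) (h₀ : f x₀ ∈ Icc a a') (ha : ∀ x ∈ Ioo p q, f x ≠ a)
    (ha' : ∀ x ∈ Ioo p q, f x ≠ a') : MapsTo f (Ioo p q) (Icc a a') := by
  intro x hx
  have hc : OrdConnected (f '' Ioo p q) := (isPreconnected_Ioo.image f hf).ordConnected
  have hmem := mem_image_of_mem f hx
  have hmem₀ := mem_image_of_mem f hx₀
  constructor
  · by_contra! h
    obtain ⟨y, hy, hya⟩ := hc.out hmem hmem₀ (show a ∈ Icc (f x) (f x₀) from ⟨h.le, h₀.1⟩)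
    exact ha y hy hya
  · by_contra! h
    obtain ⟨y, hy, hya⟩ := hc.out hmem₀ hmem (show a' ∈ Icc (f x₀) (f x) from ⟨h₀.2, h.le⟩)
    exact ha' y hy hya

/-- If `T` is `λ`-expanding with `λ > 1`, `τ` is the piecewise-linear map above, and
`2·(n + 1 + Σ_i 1/α_i) < λ`, then `τ∘T` has an invariant Borel probability measure on
`[0,1]` absolutely continuous with respect to Lebesgue measure. -/
theorem composition_has_acim {lam : ℝ} (hlam : 1 < lam) (E : ExpandingMap lam)
    {n : ℕ} (P : PiecewiseLinearMap n)
    (hK : 2 * ((n : ℝ) + 1 + ∑ i, (P.slope i)⁻¹) < lam) :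
    ∃ μ : Measure ℝ, IsProbabilityMeasure μ ∧ μ (Icc (0:ℝ) 1) = 1 ∧
      (∀ A : Set ℝ, MeasurableSet A → μ ((P.toFun ∘ E.toFun) ⁻¹' A) = μ A) ∧
      μ ≪ volume := by
  classical
  set K : ℝ := (n : ℝ) + 1 + ∑ i, (P.slope i)⁻¹ with hKdef
  have hinv : ∀ i, 0 < (P.slope i)⁻¹ := fun i => inv_pos.2 (P.slope_pos i)
  have hK1 : 1 ≤ K := by
    have h1 : 0 ≤ ∑ i, (P.slope i)⁻¹ := Finset.sum_nonneg fun i _ => (hinv i).le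
    have h2 : (0 : ℝ) ≤ n := n.cast_nonneg
    linarith
  have hK0 : 0 < K := by linarith
  have hKs : ∀ i, K⁻¹ ≤ P.slope i := fun i => by
    have h1 : (P.slope i)⁻¹ ≤ ∑ i, (P.slope i)⁻¹ :=
      Finset.single_le_sum (fun i _ => (hinv i).le) (Finset.mem_univ i)
    have h2 : (0 : ℝ) ≤ n := n.cast_nonneg
    exact inv_le_of_inv_le₀ (P.slope_pos i) (by linarith)
  have hlam0 : 0 < lam := E.lam_pos
  let N : Set ℝ := E.b '' Iic E.n ∪ ⋃ i ∈ Finset.range E.n, ⋃ j : Fin n,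
    (Icc (E.b i) (E.b (i + 1)) ∩ E.f i ⁻¹' {P.a j, P.a' j})
  have hN : N.Finite := by
    refine ((finite_Iic _).image _).union ?_
    refine Finite.biUnion (Finset.finite_toSet _) fun i hi => finite_iUnion fun j => ?_
    refine Finite.of_injOn (f := E.f i) (t := {P.a j, P.a' j}) (fun x hx => hx.2)
      ((E.inj i (Finset.mem_range.1 hi)).mono inter_subset_left) (by simp)
  let Z : Finset ℝ := hN.toFinset.filter (· ∈ Icc (0 : ℝ) 1)
  have hb01 : ∀ i ≤ E.n, E.b i ∈ Icc (0 : ℝ) 1 := fun i hi =>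
    ⟨E.b_zero ▸ E.monotoneOn_b i.zero_le hi, E.b_last ▸ E.monotoneOn_b hi le_rfl⟩
  have hbZ : ∀ i ≤ E.n, E.b i ∈ Z := fun i hi => by
    simp only [Z, Finset.mem_filter, Finite.mem_toFinset]
    exact ⟨Or.inl ⟨i, hi, rfl⟩, hb01 i hi⟩
  refine exists_acim_of_piecewise_expanding (P.meas.comp E.meas) (P.mapsTo_Icc.comp E.maps) (Z := Z)
    (s := K⁻¹ * lam) (E.b_zero ▸ hbZ 0 (Nat.zero_le _)) (E.b_last ▸ hbZ E.n le_rfl) ?_ ?_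
  · rw [inv_mul_eq_div, lt_div_iff₀ hK0]
    exact hK
  intro p hp q hq hpq hgap
  have hp01 := (Finset.mem_filter.1 hp).2
  have hq01 := (Finset.mem_filter.1 hq).2
  have hx₀ : (p + q) / 2 ∈ Ioo p q := ⟨by linarith, by linarith⟩
  set x₀ := (p + q) / 2
  obtain ⟨i, hi, hxi⟩ := E.exists_mem_Ico (x := x₀)
    ⟨hp01.1.trans hx₀.1.le, hx₀.2.trans_le hq01.2⟩
  have hbp : E.b i ≤ p := not_lt.1 fun h => hgap _ (hbZ i hi.le) ⟨h, hxi.1.trans_lt hx₀.2⟩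
  have hqb : q ≤ E.b (i + 1) := not_lt.1 fun h => hgap _ (hbZ (i + 1) hi) ⟨hx₀.1.trans hxi.2, h⟩
  have hIcc : Icc p q ⊆ Icc (E.b i) (E.b (i + 1)) := Icc_subset_Icc hbp hqb
  have hTf : ∀ x ∈ Ioo p q, E.toFun x = E.f i x := fun x hx =>
    E.eq_f i hi x ⟨hbp.trans hx.1.le, hx.2.trans_le hqb⟩
  have hf := E.f_smooth i hi
  have havoid : ∀ j : Fin n, ∀ x ∈ Ioo p q, E.f i x ≠ P.a j ∧ E.f i x ≠ P.a' j := by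
    intro j x hx
    rw [← not_or]
    intro h
    refine hgap x ?_ hx
    simp only [Z, Finset.mem_filter, Finite.mem_toFinset]
    refine ⟨Or.inr ?_, hp01.1.trans hx.1.le, hx.2.le.trans hq01.2⟩
    simp only [mem_iUnion, Finset.mem_range]
    exact ⟨i, hi, j, hIcc (Ioo_subset_Icc_self hx), h⟩
  have hin : ∀ j : Fin n, ∀ y ∈ Ioo p q, E.f i y ∈ Icc (P.a j) (P.a' j) →
      MapsTo (E.f i) (Ioo p q) (Icc (P.a j) (P.a' j)) := fun j y hy hj =>
    mapsTo_Ioo_Icc_of_avoids_endpoints hf.continuous.continuousOn hy hj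
      (fun x hx => (havoid j x hx).1) (fun x hx => (havoid j x hx).2)
  have hexp : ∀ x ∈ Icc p q, lam ≤ |deriv (E.f i) x| := fun x hx => E.expand i hi x (hIcc hx)
  have hinj : InjOn (E.f i) (Icc p q) := (E.inj i hi).mono hIcc
  by_cases hj : ∃ j : Fin n, E.f i x₀ ∈ Icc (P.a j) (P.a' j)
  · obtain ⟨j, hj⟩ := hj
    have hsl := P.slope_pos j
    refine ⟨fun x => P.slope j * E.f i x + P.c j, by fun_prop, ?_, ?_, ?_⟩
    · intro x hx y hy hxy
      exact hinj hx hy (mul_left_cancel₀ hsl.ne' (add_right_cancel hxy))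
    · intro x hx
      have hd := ((hf.differentiable (by norm_num) x).hasDerivAt.const_mul (P.slope j)).add_const (P.c j)
      rw [hd.deriv, abs_mul, abs_of_pos hsl]
      exact mul_le_mul (hKs j) (hexp x hx) hlam0.le hsl.le
    · intro x hx
      rw [Function.comp_apply, hTf x hx, P.eqA j _ (hin j x₀ hx₀ hj hx)]
  · refine ⟨E.f i, hf, hinj, fun x hx => ?_, fun x hx => ?_⟩
    · exact (mul_le_of_le_one_left hlam0.le (inv_le_one_of_one_le₀ hK1)).trans (hexp x hx)
    · rw [Function.comp_apply, hTf x hx]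
      refine P.eqId _ fun h => hj ?_
      obtain ⟨j, hjx⟩ := mem_iUnion.1 h
      exact ⟨j, hin j x hx hjx hx₀⟩
end
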